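/- Let ⟨W,R⟩ be an S4 frame with W countable, R reflexive and transitive, and designated world w0 ∈ W. Let C = {w ∈ W : R(w0,w)}, let G be the stabilizer of w0 in the automorphism group of ⟨W,R⟩, and let O ⊆ C be an infinite orbit of the action of G on C. Assume every permutation of O moving only finitely many elements extends to some element of G (property (Ext) for O). Let P be a probability measure on Ω = W → (Fin k → Bool) that is modally exchangeable at w0. Then there exists a probability measure μ_O on the space of probability measures on Fin k → Bool such that the pushforward of P under the restriction map V ↦ V|_O equals the mixture ∫ Λ^{⊗O} dμ_O(Λ), where Λ^{⊗O} is the product measure under which the coordinates {V(w)}_{w∈O} are i.i.d. with common law Λ. -/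

import Mathlib

open MeasureTheory

/-- `π` is an automorphism of the modal frame `⟨W, R⟩`. -/
def IsFrameAut {W : Type*} (R : W → W → Prop) (π : Equiv.Perm W) : Prop :=
  ∀ w v, R w v ↔ R (π w) (π v)

/-- The stabilizer of `w0` in the automorphism group of `⟨W, R⟩`. -/
def Stab {W : Type*} (R : W → W → Prop) (w0 : W) : Set (Equiv.Perm W) :=
  {π | IsFrameAut R π ∧ π w0 = w0}

/-- Action of an automorphism on valuations: `(π · V)(w) = V(π⁻¹ w)`. -/
def actV {W : Type*} {k : ℕ} (π : Equiv.Perm W) (V : W → Fin k → Bool) :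
    W → Fin k → Bool :=
  fun w => V (π.symm w)

/-- `P` is modally exchangeable at `w0`: invariant under the stabilizer action. -/
def ModallyExchangeable {W : Type*} (R : W → W → Prop) (w0 : W) {k : ℕ}
    (P : Measure (W → Fin k → Bool)) : Prop :=
  ∀ π ∈ Stab R w0, ∀ A : Set (W → Fin k → Bool), MeasurableSet A →
    P (actV π ⁻¹' A) = P A

/-- `Q` is the i.i.d. product measure on `ι → X` with common coordinate law `Λ`,
characterized by its finite-dimensional cylinder probabilities. -/
def IsIIDProduct {ι X : Type*} [MeasurableSpace X] (Λ : Measure X)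
    (Q : Measure (ι → X)) : Prop :=
  IsProbabilityMeasure Q ∧
    ∀ (s : Finset ι) (B : ι → Set X), (∀ i, MeasurableSet (B i)) →
      Q {x | ∀ i ∈ s, x i ∈ B i} = ∏ i ∈ s, Λ (B i)

open Filter Topology

lemma exists_finite_perm {ι : Type*} (s : Finset ι) (f : s → ι) (hf : Function.Injective f) :
    ∃ σ : Equiv.Perm ι, {c | σ c ≠ c}.Finite ∧ ∀ i : s, σ i.1 = f i := by
  classical
  let T : Finset ι := s ∪ Finset.univ.image f
  let e1 : s ≃ {x : T // x.1 ∈ s} :=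
    { toFun := fun i => ⟨⟨i.1, Finset.mem_union_left _ i.2⟩, i.2⟩
      invFun := fun x => ⟨x.1.1, x.2⟩
      left_inv := fun _ => rfl
      right_inv := fun _ => rfl }
  let g : s → {x : T // x.1 ∈ Set.range f} := fun i =>
    ⟨⟨f i, Finset.mem_union_right _ (Finset.mem_image_of_mem f (Finset.mem_univ i))⟩, ⟨i, rfl⟩⟩
  have hg : Function.Bijective g := by
    constructor
    · intro i j h
      apply hf
      exact congrArg (fun z => z.1.1) h
    · rintro ⟨⟨x, hx⟩, ⟨i, hi⟩⟩
      refine ⟨i, ?_⟩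
      apply Subtype.ext
      apply Subtype.ext
      exact hi
  let e : {x : T // x.1 ∈ s} ≃ {x : T // x.1 ∈ Set.range f} :=
    e1.symm.trans (Equiv.ofBijective g hg)
  let τ : Equiv.Perm T := e.extendSubtype
  refine ⟨Equiv.Perm.ofSubtype τ, ?_, ?_⟩
  · apply T.finite_toSet.subset
    intro c hc
    by_contra h
    exact hc (Equiv.Perm.ofSubtype_apply_of_not_mem τ h)
  · intro i
    have hi : i.1 ∈ T := Finset.mem_union_left _ i.2
    rw [Equiv.Perm.ofSubtype_apply_of_mem τ hi]
    have := e.extendSubtype_apply_of_mem ⟨i.1, hi⟩ i.2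
    simp only [τ]
    rw [this]
    rfl

lemma avg_bound {α : Type*} [Fintype α] [DecidableEq α] (N : ℕ) (q : (α → Fin N) → ℝ) (c : ℝ)
    (hc0 : 0 ≤ c) (hc1 : c ≤ 1) (hq0 : ∀ f, 0 ≤ q f) (hq1 : ∀ f, q f ≤ 1)
    (hq : ∀ f, Function.Injective f → q f = c) (hN : 0 < N) :
    |(∑ f, q f) / (N : ℝ) ^ Fintype.card α - c| ≤
      1 - (N.descFactorial (Fintype.card α) : ℝ) / (N : ℝ) ^ Fintype.card α := by
  classical
  have hpos : (0 : ℝ) < (N : ℝ) ^ Fintype.card α := by positivity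
  have hcard : (Fintype.card (α → Fin N) : ℝ) = (N : ℝ) ^ Fintype.card α := by simp
  have hinj : (((Finset.univ.filter (fun f : α → Fin N => Function.Injective f)).card : ℕ) : ℝ)
      = N.descFactorial (Fintype.card α) := by
    have h1 := Fintype.card_embedding_eq (α := α) (β := Fin N)
    rw [Fintype.card_fin] at h1
    rw [← h1, ← Fintype.card_subtype]
    congr 1
    exact Fintype.card_congr (Equiv.subtypeInjectiveEquivEmbedding α (Fin N))
  have key : (∑ f, q f) / (N : ℝ) ^ Fintype.card α - c
      = (∑ f, (q f - c)) / (N : ℝ) ^ Fintype.card α := by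
    rw [Finset.sum_sub_distrib, Finset.sum_const, nsmul_eq_mul, Finset.card_univ, hcard]
    field_simp
  have key2 : 1 - (N.descFactorial (Fintype.card α) : ℝ) / (N : ℝ) ^ Fintype.card α
      = (∑ f : α → Fin N, (1 - if Function.Injective f then (1 : ℝ) else 0))
        / (N : ℝ) ^ Fintype.card α := by
    rw [Finset.sum_sub_distrib, Finset.sum_const, nsmul_eq_mul, Finset.card_univ, hcard,
      Finset.sum_boole, hinj]
    field_simp
  rw [key, key2, abs_div, abs_of_pos hpos]
  gcongr
  refine (Finset.abs_sum_le_sum_abs _ _).trans (Finset.sum_le_sum fun f _ => ?_)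
  split_ifs with h
  · simp [hq f h]
  · rw [abs_le]; constructor <;> linarith [hq0 f, hq1 f]

lemma desc_tendsto (m : ℕ) :
    Tendsto (fun n : ℕ => 1 - ((n + 1).descFactorial m : ℝ) / ((n + 1 : ℕ) : ℝ) ^ m)
      atTop (𝓝 0) := by
  have h := isEquivalent_descFactorial m
  have h2 := (Asymptotics.isEquivalent_iff_tendsto_one (by
    filter_upwards [eventually_gt_atTop 0] with n hn
    have : (0 : ℝ) < n := by exact_mod_cast hn
    positivity)).1 h
  have h3 := (h2.comp (tendsto_add_atTop_nat 1)).const_sub 1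
  simpa using h3

section
variable {X : Type} [Fintype X] [MeasurableSpace X] [MeasurableSingletonClass X]

noncomputable def simplexMeas (p : stdSimplex ℝ X) : Measure X :=
  ∑ a : X, ENNReal.ofReal (p.1 a) • Measure.dirac a

open Classical in
noncomputable def simplexVal (B : Set X) (p : stdSimplex ℝ X) : ℝ :=
  ∑ a : X, if a ∈ B then p.1 a else 0

lemma simplexVal_nonneg (B : Set X) (p : stdSimplex ℝ X) : 0 ≤ simplexVal B p := by
  classical
  refine Finset.sum_nonneg fun a _ => ?_
  split_ifs
  · exact p.2.1 a
  · exact le_rfl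

lemma simplexVal_continuous (B : Set X) : Continuous (simplexVal (X := X) B) := by
  classical
  unfold simplexVal
  refine continuous_finsetSum _ fun a _ => ?_
  split_ifs
  · exact (continuous_apply a).comp continuous_subtype_val
  · exact continuous_const

lemma simplexMeas_apply (p : stdSimplex ℝ X) (B : Set X) :
    simplexMeas p B = ENNReal.ofReal (simplexVal B p) := by
  classical
  unfold simplexMeas simplexVal
  rw [ENNReal.ofReal_sum_of_nonneg]
  · simp only [Measure.coe_finsetSum, Finset.sum_apply, Measure.smul_apply, smul_eq_mul]
    refine Finset.sum_congr rfl fun a _ => ?_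
    rw [Measure.dirac_apply]
    by_cases h : a ∈ B <;> simp [h]
  · intro a _
    split_ifs
    · exact p.2.1 a
    · exact le_rfl

instance simplexMeas_prob (p : stdSimplex ℝ X) : IsProbabilityMeasure (simplexMeas p) := by
  constructor
  rw [simplexMeas_apply]
  simp [simplexVal, p.2.2]

open Classical in
noncomputable def empir {ι : Type*} (e : ℕ → ι) (n : ℕ) (x : ι → X) : stdSimplex ℝ X :=
  ⟨fun a => (∑ j : Fin (n + 1), if x (e j) = a then (1 : ℝ) else 0) / ((n + 1 : ℕ) : ℝ), by
    constructor
    · intro a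
      positivity
    · rw [← Finset.sum_div, Finset.sum_comm]
      have hn : (n : ℝ) + 1 ≠ 0 := by positivity
      simp [hn]⟩

lemma empir_measurable {ι : Type*} (e : ℕ → ι) (n : ℕ) :
    Measurable (empir (X := X) e n) := by
  classical
  refine Measurable.subtype_mk (measurable_pi_lambda _ fun a => ?_)
  refine Measurable.div_const (Finset.measurable_sum _ fun j _ => ?_) _
  exact Measurable.ite (measurableSet_eq_fun (measurable_pi_apply _) measurable_const)
    measurable_const measurable_const

open Classical in
lemma simplexVal_empir {ι : Type*} (e : ℕ → ι) (n : ℕ) (x : ι → X) (B : Set X) :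
    simplexVal B (empir e n x) =
      (∑ j : Fin (n + 1), if x (e j) ∈ B then (1 : ℝ) else 0) / ((n + 1 : ℕ) : ℝ) := by
  unfold simplexVal empir
  simp only [← Finset.sum_filter]
  rw [← Finset.sum_div]
  congr 1
  simp only [Finset.sum_filter]
  rw [Finset.sum_congr rfl (g := fun a => ∑ j : Fin (n + 1),
    if a ∈ B then (if x (e j) = a then (1 : ℝ) else 0) else 0)]
  · rw [Finset.sum_comm]
    refine Finset.sum_congr rfl fun j _ => ?_
    rw [Finset.sum_eq_single (x (e j))]
    · simp
    · intro b _ hb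
      simp [Ne.symm hb]
    · simp
  · intro a _
    split_ifs <;> simp

lemma integral_empir {ι : Type*} [DecidableEq ι] (e : ℕ → ι) (n : ℕ) (ν : Measure (ι → X))
    [IsProbabilityMeasure ν] (s : Finset ι) (B : ι → Set X) :
    ∫ p, ∏ i : s, simplexVal (B i) p ∂(ν.map (empir e n)) =
      (∑ f : s → Fin (n + 1), ν.real {x | ∀ i : s, x (e (f i)) ∈ B i})
        / ((n + 1 : ℕ) : ℝ) ^ Fintype.card s := by
  classical
  rw [integral_map (empir_measurable e n).aemeasurable
    (by exact (continuous_finsetProd _ fun i _ => simplexVal_continuous _).aestronglyMeasurable)]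
  simp only [simplexVal_empir]
  simp only [Finset.prod_div_distrib, Finset.prod_const, Finset.card_univ]
  rw [integral_div]
  congr 1
  simp only [Finset.prod_univ_sum, Fintype.piFinset_univ]
  have hm : ∀ f : s → Fin (n + 1), MeasurableSet {x : ι → X | ∀ i : s, x (e (f i)) ∈ B i} := by
    intro f
    rw [Set.ofPred_forall]
    exact MeasurableSet.iInter fun i => measurable_pi_apply _ (Set.toFinite (B i)).measurableSet
  have heq : ∀ (f : s → Fin (n + 1)) (x : ι → X),
      (∏ i : s, if x (e (f i)) ∈ B i then (1 : ℝ) else 0) =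
        Set.indicator {x : ι → X | ∀ i : s, x (e (f i)) ∈ B i} 1 x := by
    intro f x
    rw [Finset.prod_ite_zero]
    simp [Set.indicator_apply]
  simp only [heq]
  rw [integral_finsetSum]
  · refine Finset.sum_congr rfl fun f _ => ?_
    rw [integral_indicator_one (hm f)]
  · intro f _
    exact (integrable_const (1 : ℝ)).indicator (hm f)

theorem deFinetti_simplex [Nonempty X] {ι : Type*} [Infinite ι] (ν : Measure (ι → X))
    [IsProbabilityMeasure ν]
    (hν : ∀ (s : Finset ι) (B : ι → Set X) (f : s → ι), Function.Injective f →
      ν {x | ∀ i : s, x (f i) ∈ B i} = ν {x | ∀ i ∈ s, x i ∈ B i}) :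
    ∃ μ : ProbabilityMeasure (stdSimplex ℝ X), ∀ (s : Finset ι) (B : ι → Set X),
      ∫ p, ∏ i : s, simplexVal (B i) p ∂(μ : Measure (stdSimplex ℝ X)) =
        ν.real {x | ∀ i ∈ s, x i ∈ B i} := by
  classical
  let e := Infinite.natEmbedding ι
  let μs : ℕ → ProbabilityMeasure (stdSimplex ℝ X) := fun n =>
    ⟨ν.map (empir e n), Measure.isProbabilityMeasure_map (empir_measurable e n).aemeasurable⟩
  let U : Ultrafilter ℕ := Ultrafilter.of atTop
  have hU : (U : Filter ℕ) ≤ atTop := Ultrafilter.of_le atTop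
  obtain ⟨μ, -, hμ⟩ := isCompact_univ.ultrafilter_le_nhds (U.map μs) (by simp)
  have hμ' : Tendsto μs U (𝓝 μ) := hμ
  refine ⟨μ, fun s B => ?_⟩
  rw [ProbabilityMeasure.tendsto_iff_forall_integral_tendsto] at hμ'
  have h1 := hμ' (BoundedContinuousFunction.mkOfCompact
    ⟨fun p => ∏ i : s, simplexVal (B i) p,
      continuous_finsetProd _ fun i _ => simplexVal_continuous _⟩)
  simp only [BoundedContinuousFunction.mkOfCompact_apply, ContinuousMap.coe_mk] at h1
  refine tendsto_nhds_unique h1 ?_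
  refine Tendsto.mono_left ?_ hU
  rw [tendsto_iff_norm_sub_tendsto_zero]
  refine squeeze_zero (fun _ => norm_nonneg _) (fun n => ?_) (desc_tendsto (Fintype.card s))
  have : ((μs n : ProbabilityMeasure _) : Measure (stdSimplex ℝ X)) = ν.map (empir e n) := rfl
  rw [this, integral_empir, Real.norm_eq_abs]
  refine avg_bound (n + 1) _ _ measureReal_nonneg measureReal_le_one
    (fun _ => measureReal_nonneg) (fun _ => measureReal_le_one) (fun f hf => ?_) (Nat.succ_pos n)
  unfold Measure.real
  rw [hν s B (fun i => e (f i)) ?_]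
  intro i j hij
  exact hf (Fin.ext (e.injective hij))

noncomputable def iidMeas (ι : Type*) (Λ : {Λ : Measure X // IsProbabilityMeasure Λ}) :
    Measure (ι → X) :=
  haveI := Λ.2
  Measure.infinitePi (fun _ : ι => Λ.1)

lemma iidMeas_prob (ι : Type*) (Λ : {Λ : Measure X // IsProbabilityMeasure Λ}) :
    IsProbabilityMeasure (iidMeas ι Λ) := by
  haveI := Λ.2
  unfold iidMeas
  infer_instance

lemma iidMeas_box (ι : Type*) (Λ : {Λ : Measure X // IsProbabilityMeasure Λ}) (s : Finset ι)
    (B : ι → Set X) : iidMeas ι Λ ((s : Set ι).pi B) = ∏ i ∈ s, Λ.1 (B i) := by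
  haveI := Λ.2
  unfold iidMeas
  exact Measure.infinitePi_pi _ fun i _ => (Set.toFinite (B i)).measurableSet

lemma iidMeas_measurable (ι : Type*) :
    Measurable (iidMeas (X := X) ι) := by
  haveI := iidMeas_prob (X := X) ι
  refine Measurable.measure_of_isPiSystem_of_isProbabilityMeasure
    generateFrom_squareCylinders.symm
    (isPiSystem_squareCylinders (fun _ => MeasurableSpace.isPiSystem_measurableSet) (by simp)) ?_
  rintro _ ⟨s, B, hB, rfl⟩
  simp only [iidMeas_box]
  refine Finset.measurable_prod _ fun i _ => ?_
  exact (Measure.measurable_coe (Set.toFinite (B i)).measurableSet).comp measurable_subtype_coe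

lemma simplexMeas_measurable :
    Measurable (fun p : stdSimplex ℝ X =>
      (⟨simplexMeas p, simplexMeas_prob p⟩ : {Λ : Measure X // IsProbabilityMeasure Λ})) := by
  refine Measurable.subtype_mk (Measure.measurable_of_measurable_coe _ fun B _ => ?_)
  simp only [simplexMeas_apply]
  exact (simplexVal_continuous B).measurable.ennreal_ofReal

theorem deFinetti_finite [Nonempty X] {ι : Type*} [Infinite ι] (ν : Measure (ι → X))
    [IsProbabilityMeasure ν]
    (hν : ∀ (s : Finset ι) (B : ι → Set X) (f : s → ι), Function.Injective f →
      ν {x | ∀ i : s, x (f i) ∈ B i} = ν {x | ∀ i ∈ s, x i ∈ B i}) :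
    ∃ μ : Measure {Λ : Measure X // IsProbabilityMeasure Λ}, IsProbabilityMeasure μ ∧
      ∀ A, MeasurableSet A → ν A = ∫⁻ Λ, iidMeas ι Λ A ∂μ := by
  obtain ⟨μ, hμ⟩ := deFinetti_simplex ν hν
  let μO := (μ : Measure (stdSimplex ℝ X)).map (fun p : stdSimplex ℝ X =>
      (⟨simplexMeas p, simplexMeas_prob p⟩ : {Λ : Measure X // IsProbabilityMeasure Λ}))
  have hμO : IsProbabilityMeasure μO :=
    Measure.isProbabilityMeasure_map simplexMeas_measurable.aemeasurable
  refine ⟨μO, hμO, ?_⟩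
  have hm := iidMeas_measurable (X := X) ι
  haveI := iidMeas_prob (X := X) ι
  suffices h : ν = μO.bind (iidMeas ι) by
    intro A hA
    conv_lhs => rw [h]
    exact Measure.bind_apply hA hm.aemeasurable
  refine ext_of_generate_finite _ generateFrom_squareCylinders.symm
    (isPiSystem_squareCylinders (fun _ => MeasurableSpace.isPiSystem_measurableSet) (by simp)) ?_ ?_
  · rintro _ ⟨s, B, hB, rfl⟩
    have hbox : MeasurableSet ((s : Set ι).pi B) :=
      MeasurableSet.pi s.countable_toSet fun i _ => (Set.toFinite (B i)).measurableSet
    rw [Measure.bind_apply hbox hm.aemeasurable]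
    have hl : ∫⁻ Λ, iidMeas ι Λ ((s : Set ι).pi B) ∂μO = _ :=
      lintegral_map ((Measure.measurable_coe hbox).comp hm) simplexMeas_measurable
    rw [hl]
    simp only [iidMeas_box, simplexMeas_apply]
    have h1 : ∀ p : stdSimplex ℝ X, ∏ i ∈ s, ENNReal.ofReal (simplexVal (B i) p) =
        ENNReal.ofReal (∏ i : s, simplexVal (B i) p) := by
      intro p
      rw [ENNReal.ofReal_prod_of_nonneg fun i _ => simplexVal_nonneg _ _]
      exact (Finset.prod_coe_sort s (fun i => ENNReal.ofReal (simplexVal (B i) p))).symm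
    simp only [h1]
    rw [← ofReal_integral_eq_lintegral_ofReal]
    · rw [hμ s B]
      simp only [Measure.real]
      rw [ENNReal.ofReal_toReal (measure_ne_top _ _)]
      rfl
    · have hc : Continuous (fun p : stdSimplex ℝ X => ∏ i : s, simplexVal (B i) p) :=
        continuous_finsetProd _ fun i _ => simplexVal_continuous _
      exact (BoundedContinuousFunction.mkOfCompact ⟨_, hc⟩).integrable _
    · exact ae_of_all _ fun p => Finset.prod_nonneg fun i _ => simplexVal_nonneg _ _
  · rw [Measure.bind_apply MeasurableSet.univ hm.aemeasurable]
    simp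
end

/-- **Modal de Finetti, S4 case: orbit-wise representation.** -/
theorem modal_deFinetti_S4 {W : Type} [Countable W] (R : W → W → Prop)
    (hrefl : ∀ w, R w w) (htrans : ∀ u v w, R u v → R v w → R u w)
    (w0 : W) (k : ℕ) (O : Set W)
    (hOC : O ⊆ {w : W | R w0 w})
    (hOorb : ∃ v ∈ {w : W | R w0 w}, O = {w | ∃ π ∈ Stab R w0, π v = w})
    (hOinf : O.Infinite)
    (hext : ∀ σ : Equiv.Perm O, {c | σ c ≠ c}.Finite →
      ∃ π ∈ Stab R w0, ∀ c : O, π c.1 = (σ c).1)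
    (P : Measure (W → Fin k → Bool)) [IsProbabilityMeasure P]
    (hP : ModallyExchangeable R w0 P) :
    ∃ μO : Measure {Λ : Measure (Fin k → Bool) // IsProbabilityMeasure Λ},
      IsProbabilityMeasure μO ∧
      ∃ Q : {Λ : Measure (Fin k → Bool) // IsProbabilityMeasure Λ} →
          Measure (O → Fin k → Bool),
        (∀ Λ, IsIIDProduct Λ.1 (Q Λ)) ∧
        ∀ A : Set (O → Fin k → Bool), MeasurableSet A →
          Measure.map (fun (V : W → Fin k → Bool) (c : O) => V c.1) P A
            = ∫⁻ Λ, Q Λ A ∂μO := by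
  have hinf : Infinite O := hOinf.to_subtype
  have hres : Measurable (fun (V : W → Fin k → Bool) (c : O) => V c.1) :=
    measurable_pi_lambda _ fun c => measurable_pi_apply _
  have hprob : IsProbabilityMeasure
      (Measure.map (fun (V : W → Fin k → Bool) (c : O) => V c.1) P) :=
    Measure.isProbabilityMeasure_map hres.aemeasurable
  obtain ⟨μ, hμ, h⟩ := deFinetti_finite
    (Measure.map (fun (V : W → Fin k → Bool) (c : O) => V c.1) P) (by
      intro s B f hf
      obtain ⟨σ, hσ, hσf⟩ := exists_finite_perm s f hf
      obtain ⟨π, hπ, hπσ⟩ := hext σ hσ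
      have hB : ∀ i, MeasurableSet (B i) := fun i => (Set.toFinite (B i)).measurableSet
      have hm1 : MeasurableSet {x : O → Fin k → Bool | ∀ i : s, x (f i) ∈ B i} := by
        rw [Set.ofPred_forall]
        exact MeasurableSet.iInter fun i => measurable_pi_apply _ (hB i)
      have hm2 : MeasurableSet {x : O → Fin k → Bool | ∀ i ∈ s, x i ∈ B i} :=
        MeasurableSet.pi s.countable_toSet fun i _ => hB i
      rw [Measure.map_apply hres hm1, Measure.map_apply hres hm2, ← hP π hπ _ (hres hm1)]
      congr 1
      ext V
      have key : ∀ i : s, π.symm (f i).1 = i.1.1 := by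
        intro i
        rw [Equiv.symm_apply_eq, hπσ, hσf]
      simp only [Set.mem_preimage, Set.mem_ofPred_eq, actV]
      constructor
      · intro hV i hi
        have := hV ⟨i, hi⟩
        rwa [key] at this
      · intro hV i
        rw [key]
        exact hV i.1 i.2)
  exact ⟨μ, hμ, iidMeas O, fun Λ => ⟨iidMeas_prob _ Λ, fun s B _ => iidMeas_box _ Λ s B⟩, h⟩
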